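/- For a tournament T on 6 vertices, det(T) = 25 if and only if T has exactly 5 diamonds, if and only if T is switching equivalent to L_6. -/

import Mathlib

open scoped Classical

/-- A tournament: irreflexive, and between distinct vertices exactly one arc. -/
def IsTournament {V : Type*} (r : V → V → Prop) : Prop :=
  (∀ i, ¬ r i i) ∧ ∀ i j, i ≠ j → (r i j ↔ ¬ r j i)

/-- Skew-adjacency matrix of a relation. -/
noncomputable def skew {V : Type*} (r : V → V → Prop) : Matrix V V ℤ :=
  Matrix.of fun i j => if r i j then 1 else if r j i then -1 else 0

/-- Determinant of the skew-adjacency matrix. -/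
noncomputable def tdet {V : Type*} [Fintype V] [DecidableEq V] (r : V → V → Prop) : ℤ :=
  (skew r).det

/-- Determinant of the subtournament induced by a finite vertex subset. -/
noncomputable def subdet {V : Type*} [Fintype V] [DecidableEq V] (r : V → V → Prop)
    (s : Finset V) : ℤ :=
  ((skew r).submatrix (fun x : {x // x ∈ s} => x.1) (fun x : {x // x ∈ s} => x.1)).det

/-- Switch of `r` with respect to `W`: arcs between `W` and its complement are reversed. -/
def switchRel {V : Type*} (r : V → V → Prop) (W : Set V) : V → V → Prop :=
  fun i j => if (i ∈ W ↔ j ∈ W) then r i j else r j i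

/-- Switching equivalence of two tournaments on the same vertex set. -/
def SwitchEquiv {V : Type*} (r₁ r₂ : V → V → Prop) : Prop :=
  ∃ W : Set V, ∀ i j, r₂ i j ↔ switchRel r₁ W i j

def IsTransitive {V : Type*} (r : V → V → Prop) : Prop :=
  ∀ a b c, r a b → r b c → r a c

def IsTransitiveOn {V : Type*} (r : V → V → Prop) (X : Finset V) : Prop :=
  ∀ a ∈ X, ∀ b ∈ X, ∀ c ∈ X, r a b → r b c → r a c

/-- A 4-set inducing a diamond: a vertex dominating or dominated by a 3-cycle. -/
def IsDiamond {V : Type*} (r : V → V → Prop) (X : Finset V) : Prop :=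
  ∃ a b c d : V, X = {a, b, c, d} ∧ a ≠ b ∧ a ≠ c ∧ a ≠ d ∧ b ≠ c ∧ b ≠ d ∧ c ≠ d ∧
    r b c ∧ r c d ∧ r d b ∧ ((r a b ∧ r a c ∧ r a d) ∨ (r b a ∧ r c a ∧ r d a))

/-- Number of diamonds of a tournament. -/
noncomputable def numDiamonds {V : Type*} [Fintype V] (r : V → V → Prop) : ℕ :=
  Set.ncard {X : Finset V | IsDiamond r X}

/-- The tournament `L_n`: a transitive chain `u_0 → ⋯ → u_{n-2}` together with a last
vertex alternating along the chain, starting with `u_{n-1} → u_0`. -/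
def LRel (n : ℕ) : Fin n → Fin n → Prop := fun i j =>
  (j.val < n - 1 ∧ i.val < j.val) ∨
  (j.val = n - 1 ∧ i.val < n - 1 ∧ i.val % 2 = 1) ∨
  (i.val = n - 1 ∧ j.val < n - 1 ∧ j.val % 2 = 0)

/-- Join of two tournaments: all arcs from the first to the second. -/
def joinRel {A B : Type*} (r : A → A → Prop) (s : B → B → Prop) : A ⊕ B → A ⊕ B → Prop :=
  fun x y => match x, y with
  | .inl a, .inl a' => r a a'
  | .inr b, .inr b' => s b b'
  | .inl _, .inr _ => True
  | .inr _, .inl _ => False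

/-- `T⁺`: add one new vertex dominated by every vertex of `T`. -/
def plusRel {A : Type*} (r : A → A → Prop) : Option A → Option A → Prop :=
  fun x y => match x, y with
  | some a, some b => r a b
  | some _, none => True
  | _, _ => False

/-- Blowup of `r` by the family of tournaments `t`. -/
def blowupG {ι : Type*} [DecidableEq ι] (r : ι → ι → Prop) {κ : ι → Type*}
    (t : ∀ i, κ i → κ i → Prop) : (Σ i, κ i) → (Σ i, κ i) → Prop :=
  fun x y => if h : x.1 = y.1 then t y.1 (h ▸ x.2) y.2 else r x.1 y.1

/-- Transitive `(a_1,…,a_n)`-blowup of `r`. -/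
def blowup {ι : Type*} [DecidableEq ι] (r : ι → ι → Prop) (a : ι → ℕ) :
    (Σ i, Fin (a i)) → (Σ i, Fin (a i)) → Prop :=
  blowupG r (fun _ p q => p < q)

/-- Membership in `𝒟_k`: every subtournament has determinant at most `k²`. -/
def memD {V : Type*} [Fintype V] [DecidableEq V] (r : V → V → Prop) (k : ℕ) : Prop :=
  ∀ s : Finset V, subdet r s ≤ (k : ℤ) ^ 2

lemma pureA (p1 p2 p3 p4 p5 p6 G : Prop)
  (A1 : p4 → p6 → ¬ p5 → (p1 ∧ p2 ∧ p3) ∨ (¬ p1 ∧ ¬ p2 ∧ ¬ p3) → G)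
  (A2 : p5 → ¬ p6 → ¬ p4 → (p1 ∧ p3 ∧ p2) ∨ (¬ p1 ∧ ¬ p3 ∧ ¬ p2) → G)
  (B1 : p2 → p6 → ¬ p3 → (¬ p1 ∧ p4 ∧ p5) ∨ (p1 ∧ ¬ p4 ∧ ¬ p5) → G)
  (B2 : p3 → ¬ p6 → ¬ p2 → (¬ p1 ∧ p5 ∧ p4) ∨ (p1 ∧ ¬ p5 ∧ ¬ p4) → G)
  (C1 : p1 → p5 → ¬ p3 → (¬ p2 ∧ ¬ p4 ∧ p6) ∨ (p2 ∧ p4 ∧ ¬ p6) → G)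
  (C2 : p3 → ¬ p5 → ¬ p1 → (¬ p2 ∧ p6 ∧ ¬ p4) ∨ (p2 ∧ ¬ p6 ∧ p4) → G)
  (D1 : p1 → p4 → ¬ p2 → (¬ p3 ∧ ¬ p5 ∧ ¬ p6) ∨ (p3 ∧ p5 ∧ p6) → G)
  (D2 : p2 → ¬ p4 → ¬ p1 → (¬ p3 ∧ ¬ p6 ∧ ¬ p5) ∨ (p3 ∧ p6 ∧ p5) → G)
  (h : ((p1 ↔ p6) ↔ (p3 ↔ p4)) ∧ ¬ ((p1 ↔ p6) ↔ (p2 ↔ p5))) : G := by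
  by_contra hG
  simp only [hG, imp_false] at A1 A2 B1 B2 C1 C2 D1 D2
  by_cases e1 : p1 <;> by_cases e2 : p2 <;> by_cases e3 : p3 <;>
    by_cases e4 : p4 <;> by_cases e5 : p5 <;> by_cases e6 : p6 <;>
    first
    | exact absurd h (by simp only [e1, e2, e3, e4, e5, e6]; decide)
    | exact absurd A1 (by simp only [e1, e2, e3, e4, e5, e6]; decide)
    | exact absurd A2 (by simp only [e1, e2, e3, e4, e5, e6]; decide)
    | exact absurd B1 (by simp only [e1, e2, e3, e4, e5, e6]; decide)
    | exact absurd B2 (by simp only [e1, e2, e3, e4, e5, e6]; decide)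
    | exact absurd C1 (by simp only [e1, e2, e3, e4, e5, e6]; decide)
    | exact absurd C2 (by simp only [e1, e2, e3, e4, e5, e6]; decide)
    | exact absurd D1 (by simp only [e1, e2, e3, e4, e5, e6]; decide)
    | exact absurd D2 (by simp only [e1, e2, e3, e4, e5, e6]; decide)

lemma pureB (p q a b c d : Prop) : ((p ↔ (a ↔ b)) ↔ (q ↔ (c ↔ d))) ↔
    ((p ↔ q) ↔ (a ↔ (b ↔ (c ↔ d)))) := by
  by_cases p <;> by_cases q <;> by_cases a <;> by_cases b <;> by_cases c <;> by_cases d <;> simp [*]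

lemma pureC (x y e : Prop) : ((x ↔ e) ↔ (y ↔ e)) ↔ (x ↔ y) := by
  by_cases x <;> by_cases y <;> by_cases e <;> simp [*]

lemma pureE1 (a b c d : Prop) : (a ↔ (d ↔ (b ↔ c))) ↔ (a ↔ (b ↔ (c ↔ d))) := by
  by_cases a <;> by_cases b <;> by_cases c <;> by_cases d <;> simp [*]

lemma pureE2 (a b c d : Prop) : (a ↔ (c ↔ (b ↔ d))) ↔ (a ↔ (b ↔ (c ↔ d))) := by
  by_cases a <;> by_cases b <;> by_cases c <;> by_cases d <;> simp [*]

lemma pureF (p pp l ll x y : Prop) (h1 : p ↔ ¬ pp) (h2 : l ↔ ¬ ll) (h : p ↔ ((x ↔ y) ↔ l)) :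
    pp ↔ ((y ↔ x) ↔ ll) := by
  by_cases pp <;> by_cases ll <;> by_cases x <;> by_cases y <;> simp_all


lemma det_norm (a b c d e f g h i j : ℤ) :
    (!![0,1,1,1,1,1; -1,0,a,b,c,d; -1,-a,0,e,f,g; -1,-b,-e,0,h,i; -1,-c,-f,-h,0,j;
      -1,-d,-g,-i,-j,0] : Matrix (Fin 6) (Fin 6) ℤ).det =
    ((e*j-f*i+g*h) - (b*j-c*i+d*h) + (a*j-c*g+d*f) - (a*i-b*g+d*e) + (a*h-b*f+c*e))^2 := by
  simp [Matrix.det_succ_row_zero, Fin.sum_univ_succ, Fin.succAbove]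
  ring

def QF {V : Type*} (r : V → V → Prop) (a b c d : V) : Prop :=
  ((r a b ↔ r c d) ↔ (r a d ↔ r b c)) ∧ ¬ ((r a b ↔ r c d) ↔ (r a c ↔ r b d))

lemma diamond_QF {V : Type*} {r : V → V → Prop} (hT : IsTournament r) {a b c d : V}
    (hab : a ≠ b) (hac : a ≠ c) (had : a ≠ d) (hbc : b ≠ c) (hbd : b ≠ d) (hcd : c ≠ d) :
    IsDiamond r {a, b, c, d} ↔ QF r a b c d := by
  have h1 := hT.2 a b hab
  have h2 := hT.2 a c hac
  have h3 := hT.2 a d had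
  have h4 := hT.2 b c hbc
  have h5 := hT.2 b d hbd
  have h6 := hT.2 c d hcd
  constructor
  · rintro ⟨p, q, s, t, hX, n1, n2, n3, n4, n5, n6, k1, k2, k3, k4⟩
    have mp : p ∈ ({a, b, c, d} : Finset V) := by rw [hX]; simp
    have mq : q ∈ ({a, b, c, d} : Finset V) := by rw [hX]; simp
    have ms : s ∈ ({a, b, c, d} : Finset V) := by rw [hX]; simp
    have mt : t ∈ ({a, b, c, d} : Finset V) := by rw [hX]; simp
    clear hX
    simp only [Finset.mem_insert, Finset.mem_singleton] at mp mq ms mt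
    unfold QF
    rcases mp with rfl | rfl | rfl | rfl <;> rcases mq with rfl | rfl | rfl | rfl <;>
    first
    | exact absurd rfl n1
    | (rcases ms with rfl | rfl | rfl | rfl <;>
        first
        | exact absurd rfl n2
        | exact absurd rfl n4
        | (rcases mt with rfl | rfl | rfl | rfl <;>
            first
            | exact absurd rfl n3
            | exact absurd rfl n5
            | exact absurd rfl n6
            | (clear n1 n2 n3 n4 n5 n6 hab hac had hbc hbd hcd hT
               rcases k4 with ⟨k4, k5, k6⟩ | ⟨k4, k5, k6⟩ <;> simp_all)))
  · have key : ∀ p q s t : V, ({a, b, c, d} : Finset V) = {p, q, s, t} → p ≠ q → p ≠ s → p ≠ t →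
        q ≠ s → q ≠ t → s ≠ t → r q s → r s t → r t q →
        ((r p q ∧ r p s ∧ r p t) ∨ (r q p ∧ r s p ∧ r t p)) → IsDiamond r {a, b, c, d} :=
      fun p q s t h n1 n2 n3 n4 n5 n6 k1 k2 k3 k4 =>
        ⟨p, q, s, t, h, n1, n2, n3, n4, n5, n6, k1, k2, k3, k4⟩
    have A1 := key a b c d rfl hab hac had hbc hbd hcd
    have A2 := key a b d c (by ext; simp only [Finset.mem_insert, Finset.mem_singleton]; clear * -; grind) hab had hac hbd hbc hcd.symm
    have B1 := key b a c d (by ext; simp only [Finset.mem_insert, Finset.mem_singleton]; clear * -; grind) hab.symm hbc hbd hac had hcd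
    have B2 := key b a d c (by ext; simp only [Finset.mem_insert, Finset.mem_singleton]; clear * -; grind) hab.symm hbd hbc had hac hcd.symm
    have C1 := key c a b d (by ext; simp only [Finset.mem_insert, Finset.mem_singleton]; clear * -; grind) hac.symm hbc.symm hcd hab had hbd
    have C2 := key c a d b (by ext; simp only [Finset.mem_insert, Finset.mem_singleton]; clear * -; grind) hac.symm hcd hbc.symm had hab hbd.symm
    have D1 := key d a b c (by ext; simp only [Finset.mem_insert, Finset.mem_singleton]; clear * -; grind) had.symm hbd.symm hcd.symm hab hac hbc
    have D2 := key d a c b (by ext; simp only [Finset.mem_insert, Finset.mem_singleton]; clear * -; grind) had.symm hcd.symm hbd.symm hac hab hbc.symm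
    have g1 : r b a ↔ ¬ r a b := by rw [h1, not_not]
    have g2 : r c a ↔ ¬ r a c := by rw [h2, not_not]
    have g3 : r d a ↔ ¬ r a d := by rw [h3, not_not]
    have g4 : r c b ↔ ¬ r b c := by rw [h4, not_not]
    have g5 : r d b ↔ ¬ r b d := by rw [h5, not_not]
    have g6 : r d c ↔ ¬ r c d := by rw [h6, not_not]
    simp only [g1, g2, g3, g4, g5, g6] at A1 A2 B1 B2 C1 C2 D1 D2
    exact pureA _ _ _ _ _ _ _ A1 A2 B1 B2 C1 C2 D1 D2

lemma switch_tour {V : Type*} {r : V → V → Prop} (hT : IsTournament r) (W : Set V) :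
    IsTournament (switchRel r W) := by
  refine ⟨fun i => ?_, fun i j hij => ?_⟩
  · simpa [switchRel] using hT.1 i
  · have := hT.2 i j hij
    unfold switchRel
    by_cases h1 : i ∈ W <;> by_cases h2 : j ∈ W <;> simp [h1, h2] <;> tauto

lemma switch_switch {V : Type*} (r : V → V → Prop) (W : Set V) :
    switchRel (switchRel r W) W = r := by
  ext i j
  unfold switchRel
  by_cases h1 : i ∈ W <;> by_cases h2 : j ∈ W <;> simp [h1, h2]

lemma switch_iff {V : Type*} {r : V → V → Prop} (hT : IsTournament r) (W : Set V) {a b : V}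
    (h : a ≠ b) : switchRel r W a b ↔ (r a b ↔ (a ∈ W ↔ b ∈ W)) := by
  have := hT.2 a b h
  unfold switchRel
  by_cases h1 : a ∈ W <;> by_cases h2 : b ∈ W <;> simp [h1, h2] <;> tauto

lemma diamond_switch_mp {V : Type*} {r : V → V → Prop} (hT : IsTournament r) (W : Set V)
    (X : Finset V) (h : IsDiamond r X) : IsDiamond (switchRel r W) X := by
  have h' := h
  obtain ⟨a, b, c, d, rfl, hab, hac, had, hbc, hbd, hcd, -⟩ := h'
  rw [diamond_QF hT hab hac had hbc hbd hcd] at h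
  rw [diamond_QF (switch_tour hT W) hab hac had hbc hbd hcd]
  unfold QF at *
  rw [switch_iff hT W hab, switch_iff hT W hac, switch_iff hT W had, switch_iff hT W hbc,
    switch_iff hT W hbd, switch_iff hT W hcd, pureB (r a b) (r c d), pureB (r a d) (r b c),
    pureB (r a c) (r b d), pureE1 (a ∈ W) (b ∈ W) (c ∈ W) (d ∈ W), pureC,
    pureE2 (a ∈ W) (b ∈ W) (c ∈ W) (d ∈ W), pureC]
  exact h

lemma numDiamonds_switch {V : Type*} [Fintype V] {r : V → V → Prop} (hT : IsTournament r)
    (W : Set V) : numDiamonds (switchRel r W) = numDiamonds r := by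
  unfold numDiamonds
  congr 1
  ext X
  refine ⟨fun h => ?_, diamond_switch_mp hT W X⟩
  have := diamond_switch_mp (switch_tour hT W) W X h
  rwa [switch_switch] at this

lemma tdet_switch {V : Type*} [Fintype V] [DecidableEq V] {r : V → V → Prop}
    (hT : IsTournament r) (W : Set V) : tdet (switchRel r W) = tdet r := by
  unfold tdet
  have : skew (switchRel r W) = Matrix.diagonal (fun i => if i ∈ W then (-1 : ℤ) else 1) * skew r *
      Matrix.diagonal (fun i => if i ∈ W then (-1 : ℤ) else 1) := by
    ext i j
    rw [Matrix.mul_diagonal, Matrix.diagonal_mul]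
    by_cases hij : i = j
    · subst hij
      simp [skew, switchRel, hT.1 i]
    have h := hT.2 i j hij
    simp only [skew, switchRel, Matrix.of_apply]
    by_cases h1 : i ∈ W <;> by_cases h2 : j ∈ W <;> by_cases h3 : r j i <;>
      simp [h1, h2, h3, h]
  rw [this, Matrix.det_mul, Matrix.det_mul, Matrix.det_diagonal]
  have h : (∏ i : V, if i ∈ W then (-1 : ℤ) else 1) * (∏ i : V, if i ∈ W then (-1 : ℤ) else 1) = 1 := by
    rw [← Finset.prod_mul_distrib]
    apply Finset.prod_eq_one
    intro i _
    split_ifs <;> simp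
  linear_combination (skew r).det * h

lemma tdet_equiv {V U : Type*} [Fintype V] [DecidableEq V] [Fintype U] [DecidableEq U]
    (r : U → U → Prop) (e : V ≃ U) : tdet (fun i j => r (e i) (e j)) = tdet r := by
  unfold tdet
  rw [← Matrix.det_submatrix_equiv_self e (skew r)]
  rfl

lemma diamond_map {V U : Type*} (r : U → U → Prop) (e : V ≃ U) (X : Finset V)
    (h : IsDiamond (fun i j => r (e i) (e j)) X) : IsDiamond r (X.map e.toEmbedding) := by
  obtain ⟨a, b, c, d, rfl, hab, hac, had, hbc, hbd, hcd, h⟩ := h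
  refine ⟨e a, e b, e c, e d, by simp [Finset.map_insert], ?_, ?_, ?_, ?_, ?_, ?_, h⟩ <;>
    simpa

lemma numDiamonds_le {V U : Type*} [Fintype V] [Fintype U] 
    (r : U → U → Prop) (e : V ≃ U) : numDiamonds (fun i j => r (e i) (e j)) ≤ numDiamonds r := by
  unfold numDiamonds
  refine Set.ncard_le_ncard_of_injOn (fun X => X.map e.toEmbedding) (fun X h => diamond_map r e X h) 
    (fun X _ Y _ h => Finset.map_injective _ h) (Set.toFinite _)

lemma numDiamonds_equiv {V U : Type*} [Fintype V] [Fintype U] 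
    (r : U → U → Prop) (e : V ≃ U) : numDiamonds (fun i j => r (e i) (e j)) = numDiamonds r := by
  refine le_antisymm (numDiamonds_le r e) ?_
  have := numDiamonds_le (fun i j => r (e i) (e j)) e.symm
  simpa using this

def lb (i j : ℕ) : Bool :=
  (Nat.blt j 5 && Nat.blt i j) || (Nat.beq j 5 && Nat.blt i 5 && Nat.beq (i % 2) 1) ||
  (Nat.beq i 5 && Nat.blt j 5 && Nat.beq (j % 2) 0)

lemma LRel_iff (i j : Fin 6) : LRel 6 i j ↔ lb i.val j.val = true := by
  have : ∀ i j : Fin 6, ((j.val < 6 - 1 ∧ i.val < j.val) ∨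
    (j.val = 6 - 1 ∧ i.val < 6 - 1 ∧ i.val % 2 = 1) ∨
    (i.val = 6 - 1 ∧ j.val < 6 - 1 ∧ j.val % 2 = 0)) ↔ lb i.val j.val = true := by decide
  exact this i j

lemma L_tour : IsTournament (LRel 6) := by
  have h1 : ∀ i : Fin 6, ¬ (lb i.val i.val = true) := by decide
  have h2 : ∀ i j : Fin 6, i ≠ j → (lb i.val j.val = true ↔ ¬ lb j.val i.val = true) := by decide
  exact ⟨fun i => by rw [LRel_iff]; exact h1 i, fun i j h => by
    rw [LRel_iff, LRel_iff]; exact h2 i j h⟩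

def sg (b : Bool) : ℤ := bif b then 1 else -1

def insAll (a : ℕ) : List ℕ → List (List ℕ)
  | [] => [[a]]
  | b :: l => (a :: b :: l) :: (insAll a l).map (b :: ·)

def perms : List ℕ → List (List ℕ)
  | [] => [[]]
  | a :: l => (perms l).flatMap (insAll a)

def cand : List (List ℕ) :=
  (perms [1, 2, 3, 4, 5]).map (0 :: ·) ++ (perms [1, 2, 3, 4]).map (5 :: 0 :: ·)

def okl (x12 x13 x14 x15 x23 x24 x25 x34 x35 x45 : Bool) : List ℕ → Bool
  | [a0, a1, a2, a3, a4, a5] =>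
    (x12 == (lb a0 a1 ^^ lb a1 a2 ^^ lb a0 a2)) && (x13 == (lb a0 a1 ^^ lb a1 a3 ^^ lb a0 a3)) &&
    (x14 == (lb a0 a1 ^^ lb a1 a4 ^^ lb a0 a4)) && (x15 == (lb a0 a1 ^^ lb a1 a5 ^^ lb a0 a5)) &&
    (x23 == (lb a0 a2 ^^ lb a2 a3 ^^ lb a0 a3)) && (x24 == (lb a0 a2 ^^ lb a2 a4 ^^ lb a0 a4)) &&
    (x25 == (lb a0 a2 ^^ lb a2 a5 ^^ lb a0 a5)) && (x34 == (lb a0 a3 ^^ lb a3 a4 ^^ lb a0 a4)) &&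
    (x35 == (lb a0 a3 ^^ lb a3 a5 ^^ lb a0 a5)) && (x45 == (lb a0 a4 ^^ lb a4 a5 ^^ lb a0 a5))
  | _ => false

def pfI (a b c d e f g h i j : ℤ) : ℤ :=
  (e*j-f*i+g*h) - (b*j-c*i+d*h) + (a*j-c*g+d*f) - (a*i-b*g+d*e) + (a*h-b*f+c*e)

def qb (ab ac ad bc bd cd : Bool) : ℕ :=
  bif ((ab == cd) == (ad == bc)) && !((ab == cd) == (ac == bd)) then 1 else 0

def cnt (x12 x13 x14 x15 x23 x24 x25 x34 x35 x45 : Bool) : ℕ :=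
  qb true true true x12 x13 x23 + qb true true true x12 x14 x24 + qb true true true x12 x15 x25 +
  qb true true true x13 x14 x34 + qb true true true x13 x15 x35 + qb true true true x14 x15 x45 +
  qb true true true x23 x24 x34 + qb true true true x23 x25 x35 + qb true true true x24 x25 x45 +
  qb true true true x34 x35 x45 +
  qb x12 x13 x14 x23 x24 x34 + qb x12 x13 x15 x23 x25 x35 + qb x12 x14 x15 x24 x25 x45 +
  qb x13 x14 x15 x34 x35 x45 + qb x23 x24 x25 x34 x35 x45

def isG (x12 x13 x14 x15 x23 x24 x25 x34 x35 x45 : Bool) : Bool :=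
  decide (pfI (sg x12) (sg x13) (sg x14) (sg x15) (sg x23) (sg x24) (sg x25) (sg x34) (sg x35)
    (sg x45) ^ 2 = 25)

lemma main_check : ∀ x12 x13 x14 x15 x23 x24 x25 x34 x35 x45 : Bool,
    ((isG x12 x13 x14 x15 x23 x24 x25 x34 x35 x45 ==
      Nat.beq (cnt x12 x13 x14 x15 x23 x24 x25 x34 x35 x45) 5) &&
    (!(isG x12 x13 x14 x15 x23 x24 x25 x34 x35 x45) ||
      cand.any (okl x12 x13 x14 x15 x23 x24 x25 x34 x35 x45))) = true := by
  decide +kernel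

lemma cand_valid : ∀ l ∈ cand, l.Nodup ∧ l.length = 6 ∧ ∀ a ∈ l, a < 6 := by
  decide +kernel

lemma four_sets : ∀ X ∈ (Finset.powersetCard 4 (Finset.univ : Finset (Fin 6))), X ∈
    ({{0,1,2,3},{0,1,2,4},{0,1,2,5},{0,1,3,4},{0,1,3,5},{0,1,4,5},{0,2,3,4},{0,2,3,5},{0,2,4,5},
    {0,3,4,5},{1,2,3,4},{1,2,3,5},{1,2,4,5},{1,3,4,5},{2,3,4,5}} : Finset (Finset (Fin 6))) := by
  decide +kernel

lemma diamond_card {V : Type*} (r : V → V → Prop) (X : Finset V) (h : IsDiamond r X) :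
    X.card = 4 := by
  obtain ⟨a, b, c, d, rfl, hab, hac, had, hbc, hbd, hcd, -⟩ := h
  rw [Finset.card_insert_of_notMem, Finset.card_insert_of_notMem, Finset.card_insert_of_notMem,
    Finset.card_singleton] <;> simp [*]

lemma num_formula (r : Fin 6 → Fin 6 → Prop) : numDiamonds r = ∑ X ∈
    ({{0,1,2,3},{0,1,2,4},{0,1,2,5},{0,1,3,4},{0,1,3,5},{0,1,4,5},{0,2,3,4},{0,2,3,5},{0,2,4,5},
    {0,3,4,5},{1,2,3,4},{1,2,3,5},{1,2,4,5},{1,3,4,5},{2,3,4,5}} : Finset (Finset (Fin 6))),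
    if IsDiamond r X then 1 else 0 := by
  rw [← Finset.card_filter, numDiamonds, ← Set.ncard_coe_finset]
  congr 1
  ext X
  simp only [Set.mem_ofPred_eq, Finset.coe_filter]
  refine ⟨fun h => ⟨four_sets X ?_, h⟩, fun h => h.2⟩
  rw [Finset.mem_powersetCard]
  exact ⟨Finset.subset_univ _, diamond_card r X h⟩

lemma ite_qb {V : Type*} {r : V → V → Prop} (hT : IsTournament r) {a b c d : V}
    (hab : a ≠ b) (hac : a ≠ c) (had : a ≠ d) (hbc : b ≠ c) (hbd : b ≠ d) (hcd : c ≠ d)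
    (X : Finset V) (hX : X = {a, b, c, d}) :
    (if IsDiamond r X then 1 else 0) =
      qb (decide (r a b)) (decide (r a c)) (decide (r a d)) (decide (r b c)) (decide (r b d))
        (decide (r c d)) := by
  subst hX
  simp only [diamond_QF hT hab hac had hbc hbd hcd, QF]
  by_cases e1 : r a b <;> by_cases e2 : r a c <;> by_cases e3 : r a d <;>
    by_cases e4 : r b c <;> by_cases e5 : r b d <;> by_cases e6 : r c d <;>
    simp [e1, e2, e3, e4, e5, e6, qb]

lemma num_cnt (r : Fin 6 → Fin 6 → Prop) (hT : IsTournament r) (h0 : ∀ k, k ≠ 0 → r 0 k) :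
    numDiamonds r = cnt (decide (r 1 2)) (decide (r 1 3)) (decide (r 1 4)) (decide (r 1 5))
      (decide (r 2 3)) (decide (r 2 4)) (decide (r 2 5)) (decide (r 3 4)) (decide (r 3 5))
      (decide (r 4 5)) := by
  rw [num_formula]
  have T : ∀ k, k ≠ 0 → decide (r 0 k) = true := fun k hk => by simpa using h0 k hk
  have t1 := T 1 (by decide)
  have t2 := T 2 (by decide)
  have t3 := T 3 (by decide)
  have t4 := T 4 (by decide)
  have t5 := T 5 (by decide)
  repeat rw [Finset.sum_insert (by decide +kernel)]
  rw [Finset.sum_singleton]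
  rw [ite_qb hT (a := 0) (b := 1) (c := 2) (d := 3) (by decide) (by decide) (by decide) (by decide) (by decide) (by decide) {0,1,2,3} (by ext; simp),
    ite_qb hT (a := 0) (b := 1) (c := 2) (d := 4) (by decide) (by decide) (by decide) (by decide) (by decide) (by decide) {0,1,2,4} (by ext; simp),
    ite_qb hT (a := 0) (b := 1) (c := 2) (d := 5) (by decide) (by decide) (by decide) (by decide) (by decide) (by decide) {0,1,2,5} (by ext; simp),
    ite_qb hT (a := 0) (b := 1) (c := 3) (d := 4) (by decide) (by decide) (by decide) (by decide) (by decide) (by decide) {0,1,3,4} (by ext; simp),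
    ite_qb hT (a := 0) (b := 1) (c := 3) (d := 5) (by decide) (by decide) (by decide) (by decide) (by decide) (by decide) {0,1,3,5} (by ext; simp),
    ite_qb hT (a := 0) (b := 1) (c := 4) (d := 5) (by decide) (by decide) (by decide) (by decide) (by decide) (by decide) {0,1,4,5} (by ext; simp),
    ite_qb hT (a := 0) (b := 2) (c := 3) (d := 4) (by decide) (by decide) (by decide) (by decide) (by decide) (by decide) {0,2,3,4} (by ext; simp),
    ite_qb hT (a := 0) (b := 2) (c := 3) (d := 5) (by decide) (by decide) (by decide) (by decide) (by decide) (by decide) {0,2,3,5} (by ext; simp),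
    ite_qb hT (a := 0) (b := 2) (c := 4) (d := 5) (by decide) (by decide) (by decide) (by decide) (by decide) (by decide) {0,2,4,5} (by ext; simp),
    ite_qb hT (a := 0) (b := 3) (c := 4) (d := 5) (by decide) (by decide) (by decide) (by decide) (by decide) (by decide) {0,3,4,5} (by ext; simp),
    ite_qb hT (a := 1) (b := 2) (c := 3) (d := 4) (by decide) (by decide) (by decide) (by decide) (by decide) (by decide) {1,2,3,4} (by ext; simp),
    ite_qb hT (a := 1) (b := 2) (c := 3) (d := 5) (by decide) (by decide) (by decide) (by decide) (by decide) (by decide) {1,2,3,5} (by ext; simp),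
    ite_qb hT (a := 1) (b := 2) (c := 4) (d := 5) (by decide) (by decide) (by decide) (by decide) (by decide) (by decide) {1,2,4,5} (by ext; simp),
    ite_qb hT (a := 1) (b := 3) (c := 4) (d := 5) (by decide) (by decide) (by decide) (by decide) (by decide) (by decide) {1,3,4,5} (by ext; simp),
    ite_qb hT (a := 2) (b := 3) (c := 4) (d := 5) (by decide) (by decide) (by decide) (by decide) (by decide) (by decide) {2,3,4,5} (by ext; simp),
    t1, t2, t3, t4, t5]
  simp only [cnt]
  ring

lemma det_cnt (r : Fin 6 → Fin 6 → Prop) (hT : IsTournament r) (h0 : ∀ k, k ≠ 0 → r 0 k) :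
    tdet r = (pfI (sg (decide (r 1 2))) (sg (decide (r 1 3))) (sg (decide (r 1 4)))
      (sg (decide (r 1 5))) (sg (decide (r 2 3))) (sg (decide (r 2 4))) (sg (decide (r 2 5)))
      (sg (decide (r 3 4))) (sg (decide (r 3 5))) (sg (decide (r 4 5)))) ^ 2 := by
  have D : ∀ i, skew r i i = 0 := fun i => by simp [skew, hT.1 i]
  have U : ∀ i j, i ≠ j → skew r i j = sg (decide (r i j)) := fun i j h => by
    have := hT.2 i j h
    by_cases h1 : r j i <;> simp [skew, sg, h1, this]
  have S : ∀ i j, i ≠ j → skew r i j = - sg (decide (r j i)) := fun i j h => by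
    have := hT.2 i j h
    by_cases h1 : r j i <;> simp [skew, sg, h1, this]
  have Z : ∀ k, k ≠ 0 → skew r 0 k = 1 := fun k hk => by simp [skew, h0 k hk]
  have Y : ∀ k, k ≠ 0 → skew r k 0 = -1 := fun k hk => by
    rw [S k 0 hk]; simp [sg, h0 k hk]
  unfold tdet pfI
  rw [← det_norm]
  congr 1
  ext i j
  fin_cases i <;> fin_cases j <;> first
    | exact D _
    | exact Z _ (by decide)
    | exact Y _ (by decide)
    | exact U _ _ (by decide)
    | exact S _ _ (by decide)

lemma switch_of_signs {V : Type*} {r l : V → V → Prop} (hr : IsTournament r) (hl : IsTournament l)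
    (o : V) (h0 : ∀ k, k ≠ o → r o k)
    (h : ∀ i j, i ≠ o → j ≠ o → i ≠ j → (r i j ↔ ((l o i ↔ l o j) ↔ l i j))) :
    SwitchEquiv r l := by
  refine ⟨{k | l k o}, fun i j => ?_⟩
  by_cases hij : i = j
  · subst hij
    simp [switchRel, hr.1 i, hl.1 i]
  by_cases hi : i = o
  · subst hi
    have a1 := h0 j (Ne.symm hij)
    have a2 := hr.2 i j hij
    have a3 := hl.2 i j hij
    have a4 := hl.1 i
    by_cases b : l j i <;> simp [switchRel, a4, b] <;> tauto
  by_cases hj : j = o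
  · subst hj
    have a1 := h0 i hij
    have a2 := hr.2 i j hij
    have a3 := hl.2 i j hij
    have a4 := hl.1 j
    by_cases b : l i j <;> simp [switchRel, a4, b] <;> tauto
  have a1 := h i j hi hj hij
  have a2 := hr.2 i j hij
  have a3 := hl.2 i j hij
  have a4 := hl.2 o i (Ne.symm hi)
  have a5 := hl.2 o j (Ne.symm hj)
  by_cases b : l i o <;> by_cases c : l j o <;> simp [switchRel, b, c] <;> tauto

lemma SwitchEquiv.of_switch {V : Type*} {r l : V → V → Prop} (W : Set V)
    (h : SwitchEquiv (switchRel r W) l) : SwitchEquiv r l := by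
  obtain ⟨U, hU⟩ := h
  refine ⟨{k | ¬ (k ∈ W ↔ k ∈ U)}, fun i j => ?_⟩
  rw [hU]
  by_cases a : i ∈ W <;> by_cases b : j ∈ W <;> by_cases c : i ∈ U <;> by_cases d : j ∈ U <;>
    simp [switchRel, a, b, c, d]

lemma normal_case (r : Fin 6 → Fin 6 → Prop) (hT : IsTournament r) (h0 : ∀ k, k ≠ 0 → r 0 k) :
    (tdet r = 25 ↔ numDiamonds r = 5) ∧
    (tdet r = 25 → ∃ e : Fin 6 ≃ Fin 6, SwitchEquiv r (fun i j => LRel 6 (e i) (e j))) := by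
  have M := main_check (decide (r 1 2)) (decide (r 1 3)) (decide (r 1 4)) (decide (r 1 5))
      (decide (r 2 3)) (decide (r 2 4)) (decide (r 2 5)) (decide (r 3 4)) (decide (r 3 5))
      (decide (r 4 5))
  rw [Bool.and_eq_true] at M
  obtain ⟨M1, M2⟩ := M
  rw [beq_iff_eq, isG, ← det_cnt r hT h0, ← num_cnt r hT h0, Bool.eq_iff_iff, decide_eq_true_iff,
    Nat.beq_eq] at M1
  refine ⟨M1, fun hd => ?_⟩
  rw [isG, ← det_cnt r hT h0, decide_eq_true hd, Bool.not_true, Bool.false_or, List.any_eq_true] at M2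
  obtain ⟨p, hp, hok⟩ := M2
  obtain ⟨hnd, hlen, hlt⟩ := cand_valid p hp
  clear hp
  match p, hnd, hlen, hlt, hok with
  | [a0, a1, a2, a3, a4, a5], hnd, hlen, hlt, hok =>
    have hinj : Function.Injective (fun i : Fin 6 =>
        (⟨([a0, a1, a2, a3, a4, a5] : List ℕ).get i, hlt _ (List.get_mem _ _)⟩ : Fin 6)) := by
      intro i j hij
      have := Fin.mk.inj hij
      exact (List.nodup_iff_injective_get.1 hnd) this
    have hbij := Finite.injective_iff_bijective.1 hinj
    refine ⟨Equiv.ofBijective _ hbij, ?_⟩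
    generalize hee : Equiv.ofBijective _ hbij = e
    have e0 : (e 0).val = a0 := by rw [← hee]; rfl
    have e1 : (e 1).val = a1 := by rw [← hee]; rfl
    have e2 : (e 2).val = a2 := by rw [← hee]; rfl
    have e3 : (e 3).val = a3 := by rw [← hee]; rfl
    have e4 : (e 4).val = a4 := by rw [← hee]; rfl
    have e5 : (e 5).val = a5 := by rw [← hee]; rfl
    have hl : IsTournament (fun i j => LRel 6 (e i) (e j)) :=
      ⟨fun i => L_tour.1 _, fun i j h => L_tour.2 _ _ (fun h' => h (e.injective h'))⟩
    clear hee hbij hinj hnd hlen hlt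
    subst e0 e1 e2 e3 e4 e5
    simp only [okl, Bool.and_eq_true, beq_iff_eq] at hok
    obtain ⟨⟨⟨⟨⟨⟨⟨⟨⟨o1, o2⟩, o3⟩, o4⟩, o5⟩, o6⟩, o7⟩, o8⟩, o9⟩, o10⟩ := hok
    have C : ∀ i j : Fin 6, (decide (r i j) = (lb (e 0).val (e i).val ^^ lb (e i).val (e j).val ^^
        lb (e 0).val (e j).val)) → (r i j ↔ ((LRel 6 (e 0) (e i) ↔ LRel 6 (e 0) (e j)) ↔
        LRel 6 (e i) (e j))) := by
      intro i j h
      rw [LRel_iff, LRel_iff, LRel_iff, ← decide_eq_true_iff (p := r i j), h]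
      generalize lb (e 0).val (e i).val = x
      generalize lb (e i).val (e j).val = y
      generalize lb (e 0).val (e j).val = z
      revert x y z
      decide
    have F : ∀ i j : Fin 6, i ≠ j → (r i j ↔ ((LRel 6 (e 0) (e i) ↔ LRel 6 (e 0) (e j)) ↔
        LRel 6 (e i) (e j))) → (r j i ↔ ((LRel 6 (e 0) (e j) ↔ LRel 6 (e 0) (e i)) ↔
        LRel 6 (e j) (e i))) := by
      intro i j hij h
      exact pureF _ _ _ _ _ _ (hT.2 i j hij) (hl.2 i j hij) h
    have G : ∀ i j : Fin 6, i ≠ 0 → i < j → (r i j ↔ ((LRel 6 (e 0) (e i) ↔ LRel 6 (e 0) (e j)) ↔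
        LRel 6 (e i) (e j))) := by
      intro i j h1 h2
      apply C
      fin_cases i <;> fin_cases j <;> first | exact absurd h2 (by decide) | exact absurd rfl h1 | assumption
    refine switch_of_signs hT hl 0 h0 (fun i j hi hj hij => ?_)
    rcases lt_or_gt_of_ne hij with h | h
    · exact G i j hi h
    · exact F j i hij.symm (G j i hj h)

lemma L_det : tdet (LRel 6) = 25 := by
  have hT := L_tour
  rw [← tdet_switch hT {k | LRel 6 k 0}]
  rw [det_cnt _ (switch_tour hT _)]
  · simp only [switchRel, LRel_iff, Set.mem_ofPred_eq]
    have : ∀ i j : Fin 6, lb i.val j.val = lb i j := fun _ _ => rfl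
    simp [lb, sg, pfI, Nat.blt, Nat.beq]
  · intro k hk
    have := hT.2 0 k hk.symm
    have := hT.1 0
    by_cases h : LRel 6 k 0 <;> simp [switchRel, *]

lemma fin_case (r : Fin 6 → Fin 6 → Prop) (hT : IsTournament r) :
    (tdet r = 25 ↔ numDiamonds r = 5) ∧
    (tdet r = 25 → ∃ e : Fin 6 ≃ Fin 6, SwitchEquiv r (fun i j => LRel 6 (e i) (e j))) := by
  have := normal_case (switchRel r {k | r k 0}) (switch_tour hT _) (by
    intro k hk
    have := hT.2 0 k hk.symm
    have := hT.1 0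
    by_cases h : r k 0 <;> simp [switchRel, *])
  rw [tdet_switch hT, numDiamonds_switch hT] at this
  exact ⟨this.1, fun h => (this.2 h).imp fun e he => he.of_switch⟩

theorem stmt12 {V : Type*} [Fintype V] [DecidableEq V] (r : V → V → Prop)
    (hT : IsTournament r) (hcard : Fintype.card V = 6) :
    (tdet r = 25 ↔ numDiamonds r = 5) ∧
    (tdet r = 25 ↔ ∃ e : V ≃ Fin 6, SwitchEquiv r (fun i j => LRel 6 (e i) (e j))) := by
  have f : V ≃ Fin 6 := Fintype.equivFinOfCardEq hcard
  have key := fin_case (fun i j => r (f.symm i) (f.symm j))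
    ⟨fun i => hT.1 _, fun i j h => hT.2 _ _ (fun h' => h (f.symm.injective h'))⟩
  rw [tdet_equiv r f.symm, numDiamonds_equiv r f.symm] at key
  refine ⟨key.1, fun h => ?_, ?_⟩
  · obtain ⟨e, W, hW⟩ := key.2 h
    refine ⟨f.trans e, f ⁻¹' W, fun i j => ?_⟩
    have := hW (f i) (f j)
    simpa [switchRel] using this
  · rintro ⟨e, W, hW⟩
    have h1 : (fun i j => LRel 6 (e i) (e j)) = switchRel r W := by
      ext i j
      exact hW i j
    rw [← tdet_switch hT W, ← h1, tdet_equiv, L_det]
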